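/- arXiv:2102.13273 — 3 statements merged into one kernel-verified Lean document; each statement's English description precedes it below -/
import Mathlib

section
/- Let c ∈ ℝ^n, q ∈ ℝ^l, b ∈ ℝ^k, W ∈ ℝ^{k×l}, H ∈ ℝ^{k×n}, F ∈ ℝ^{k×m}, and define Q(z,y) := inf{qᵀu : u ∈ ℝ^l, W u ≥ b − H z + F y} and G(z,y) := cᵀz + Q(z,y). Suppose the dual feasible set D = {π ∈ ℝ^k : π ≥ 0, Wᵀπ = q} is nonempty and bounded with ‖π‖ ≤ K₂ for all π ∈ D. Then for every z ∈ ℝ^n with ‖z‖ ≤ K₁ and every y ∈ ℝ^m, |G(z,y)| ≤ K₁ ‖c‖ + K₂ (‖b‖ + ‖H‖ K₁ + ‖F‖ ‖y‖), where ‖H‖ and ‖F‖ are operator norms with respect to Euclidean norms. -/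
open Matrix

/-- The recourse value function `Q(z,y) = inf {qᵀu : W u ≥ b − H z + F y}`. -/
noncomputable def recourseQ {k l n m : ℕ} (W : Matrix (Fin k) (Fin l) ℝ) (q : Fin l → ℝ)
    (b : Fin k → ℝ) (H : Matrix (Fin k) (Fin n) ℝ) (F : Matrix (Fin k) (Fin m) ℝ)
    (z : EuclideanSpace ℝ (Fin n)) (y : EuclideanSpace ℝ (Fin m)) : ℝ :=
  sInf {v : ℝ | ∃ u : Fin l → ℝ,
    (∀ i, b i - H.mulVec z i + F.mulVec y i ≤ W.mulVec u i) ∧ v = q ⬝ᵥ u}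

/-- The operator norm of a matrix with respect to Euclidean norms. -/
noncomputable def euclideanOpNorm {a b : ℕ} (M : Matrix (Fin a) (Fin b) ℝ) : ℝ :=
  ‖LinearMap.toContinuousLinearMap (Matrix.toEuclideanLin M)‖

/-- A linear program whose dual feasible set is nonempty with trivial recession cone has feasible
points of value below any strict upper bound of the dual objective. -/
lemma exists_feasible_dotProduct_lt {k l : ℕ} (W : Matrix (Fin k) (Fin l) ℝ) (q : Fin l → ℝ)
    (r : Fin k → ℝ) (M : ℝ) (hne : ∃ π : Fin k → ℝ, (∀ i, 0 ≤ π i) ∧ Wᵀ.mulVec π = q)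
    (hrec : ∀ d : Fin k → ℝ, (∀ i, 0 ≤ d i) → Wᵀ.mulVec d = 0 → d = 0)
    (hM : ∀ π : Fin k → ℝ, (∀ i, 0 ≤ π i) → Wᵀ.mulVec π = q → π ⬝ᵥ r < M) :
    ∃ u : Fin l → ℝ, (∀ i, r i ≤ W.mulVec u i) ∧ q ⬝ᵥ u < M := by
  let A : (Option (Fin k) → ℝ) →ₗ[ℝ] (Fin l → ℝ) × ℝ :=
    Fintype.linearCombination ℝ
      (fun o : Option (Fin k) => o.elim ((-q, -M) : (Fin l → ℝ) × ℝ) (fun i => (W i, r i)))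
  have hA : ∀ w, A w = (Wᵀ.mulVec (fun i => w (some i)) - w none • q,
      (fun i => w (some i)) ⬝ᵥ r - w none * M) := by
    intro w
    simp only [A, Fintype.linearCombination_apply, Fintype.sum_option, Option.elim]
    ext j
    · simp [Prod.fst_sum, Matrix.mulVec, dotProduct, mul_comm]
      ring
    · simp [Prod.snd_sum, dotProduct]
      ring
  have hdisj : Disjoint (A '' stdSimplex ℝ (Option (Fin k)))
      (({0} : Set (Fin l → ℝ)) ×ˢ Set.Ici (0 : ℝ)) := by
    rw [Set.disjoint_left]
    rintro _ ⟨w, ⟨hw0, hw1⟩, rfl⟩ h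
    rw [hA] at h
    obtain ⟨h1, h2⟩ := h
    simp only [Set.mem_singleton_iff, Set.mem_Ici] at h1 h2
    rw [Fintype.sum_option] at hw1
    rcases (hw0 none).eq_or_lt with h0 | h0
    · rw [← h0, zero_smul, sub_zero] at h1
      have hd := hrec _ (fun i => hw0 (some i)) h1
      have : ∀ i, w (some i) = 0 := fun i => congrFun hd i
      simp [this, ← h0] at hw1
    · have := hM ((w none)⁻¹ • fun i => w (some i))
        (fun i => mul_nonneg (inv_nonneg.2 h0.le) (hw0 _)) (by
          rw [Matrix.mulVec_smul, sub_eq_zero.1 h1, smul_smul, inv_mul_cancel₀ h0.ne', one_smul])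
      rw [smul_dotProduct, smul_eq_mul, inv_mul_lt_iff₀ h0] at this
      linarith
  obtain ⟨f, a, a', hfa, haa, hfb⟩ := geometric_hahn_banach_compact_closed
    ((convex_stdSimplex ℝ _).linear_image A)
    ((isCompact_stdSimplex ℝ (Option (Fin k))).image A.continuous_of_finiteDimensional)
    ((convex_singleton (0 : Fin l → ℝ)).prod (convex_Ici (0 : ℝ)))
    (isClosed_singleton.prod isClosed_Ici) hdisj
  let v : Fin l → ℝ := fun j => f (fun i => if j = i then 1 else 0, 0)
  let s : ℝ := f (0, 1)
  have hf : ∀ x t, f (x, t) = x ⬝ᵥ v + t * s := by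
    intro x t
    have h1 := LinearMap.pi_apply_eq_sum_univ
      ((f : (Fin l → ℝ) × ℝ →ₗ[ℝ] ℝ) ∘ₗ LinearMap.inl ℝ (Fin l → ℝ) ℝ) x
    have h2 : f (0, t) = t * s := by
      rw [← smul_eq_mul, ← map_smul]; simp
    have h3 : (x, t) = (x, (0 : ℝ)) + ((0 : Fin l → ℝ), t) := by simp
    rw [h3, map_add, h2]
    exact congrArg (· + t * s) h1
  have ha' : a' < 0 := by simpa [hf] using hfb (0, 0) (by simp)
  have hs : 0 ≤ s := by
    by_contra! hs
    have := hfb (0, a' / s) (by simpa using div_nonneg_of_nonpos ha'.le hs.le)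
    rw [hf, div_mul_cancel₀ _ hs.ne, zero_dotProduct, zero_add] at this
    exact lt_irrefl _ this
  have hneg : ∀ o : Option (Fin k), f (A (Pi.single o 1)) < 0 := fun o =>
    ((hfa _ ⟨_, single_mem_stdSimplex ℝ o, rfl⟩).trans haa).trans ha'
  have hrow : ∀ i, W.mulVec v i + r i * s < 0 := fun i => by
    have := hneg (some i)
    rwa [Fintype.linearCombination_apply_single, one_smul, Option.elim, hf] at this
  have hobj : 0 < q ⬝ᵥ v + M * s := by
    have := hneg none
    rw [Fintype.linearCombination_apply_single, one_smul, Option.elim, hf, neg_dotProduct] at this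
    linarith
  have hs' : 0 < s := by
    refine hs.lt_of_ne fun h0 => ?_
    obtain ⟨π, hπ, rfl⟩ := hne
    rw [← h0, mul_zero, add_zero, Matrix.mulVec_transpose, ← Matrix.dotProduct_mulVec] at hobj
    refine hobj.not_ge (Finset.sum_nonpos fun i _ => mul_nonpos_of_nonneg_of_nonpos (hπ i) ?_)
    have := hrow i
    rw [← h0, mul_zero, add_zero] at this
    exact this.le
  refine ⟨-s⁻¹ • v, fun i => ?_, ?_⟩
  · rw [Matrix.mulVec_smul, Pi.smul_apply, smul_eq_mul, neg_mul, le_neg, inv_mul_le_iff₀ hs']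
    linarith [hrow i]
  · rw [dotProduct_smul, smul_eq_mul, neg_mul, neg_lt, lt_inv_mul_iff₀ hs']
    linarith

/-- The recession cone of a nonempty bounded set `{π ≥ 0 : Wᵀπ = q}` is trivial. -/
lemma eq_zero_of_mulVec_eq_zero_of_norm_le {k l : ℕ} (W : Matrix (Fin k) (Fin l) ℝ)
    (q : Fin l → ℝ) (K : ℝ) (π₀ : EuclideanSpace ℝ (Fin k)) (hπ₀ : ∀ i, 0 ≤ π₀ i)
    (hWπ₀ : Wᵀ.mulVec π₀ = q)
    (hK : ∀ π : EuclideanSpace ℝ (Fin k), (∀ i, 0 ≤ π i) → Wᵀ.mulVec π = q → ‖π‖ ≤ K)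
    (d : Fin k → ℝ) (hd : ∀ i, 0 ≤ d i) (hWd : Wᵀ.mulVec d = 0) : d = 0 := by
  by_contra hne
  have hpos : 0 < ‖WithLp.toLp 2 d‖ := by simpa using hne
  have hray : ∀ t : ℝ, 0 ≤ t → t * ‖WithLp.toLp 2 d‖ ≤ K + K := by
    intro t ht
    have h1 := hK (π₀ + t • WithLp.toLp 2 d)
      (fun i => add_nonneg (hπ₀ i) (mul_nonneg ht (hd i)))
      (by simp [Matrix.mulVec_add, Matrix.mulVec_smul, hWd, hWπ₀])
    have h2 := norm_sub_le (π₀ + t • WithLp.toLp 2 d) π₀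
    rw [add_sub_cancel_left, norm_smul, Real.norm_of_nonneg ht] at h2
    linarith [hK π₀ hπ₀ hWπ₀]
  have hK0 : 0 ≤ K := (norm_nonneg _).trans (hK π₀ hπ₀ hWπ₀)
  have := hray ((K + K + 1) / ‖WithLp.toLp 2 d‖) (by positivity)
  rw [div_mul_cancel₀ _ hpos.ne'] at this
  linarith

lemma norm_toEuclideanLin_le {a b : ℕ} (M : Matrix (Fin a) (Fin b) ℝ)
    (x : EuclideanSpace ℝ (Fin b)) :
    ‖Matrix.toEuclideanLin M x‖ ≤ euclideanOpNorm M * ‖x‖ :=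
  (LinearMap.toContinuousLinearMap (Matrix.toEuclideanLin M)).le_opNorm x

lemma abs_dotProduct_le_norm_mul_norm {k : ℕ} (x y : EuclideanSpace ℝ (Fin k)) :
    |x.ofLp ⬝ᵥ y.ofLp| ≤ ‖x‖ * ‖y‖ := by
  simpa [PiLp.inner_apply, dotProduct, mul_comm] using abs_real_inner_le_norm x y

/-- A linear program with nonempty bounded dual feasible set has value at most the dual radius
times the norm of the right-hand side. -/
lemma abs_sInf_le_of_dual_bounded {k l : ℕ} (W : Matrix (Fin k) (Fin l) ℝ) (q : Fin l → ℝ)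
    (r : EuclideanSpace ℝ (Fin k)) (K : ℝ)
    (hne : ∃ π : EuclideanSpace ℝ (Fin k), (∀ i, 0 ≤ π i) ∧ Wᵀ.mulVec π = q)
    (hK : ∀ π : EuclideanSpace ℝ (Fin k), (∀ i, 0 ≤ π i) → Wᵀ.mulVec π = q → ‖π‖ ≤ K) :
    |sInf {v : ℝ | ∃ u : Fin l → ℝ, (∀ i, r i ≤ W.mulVec u i) ∧ v = q ⬝ᵥ u}| ≤ K * ‖r‖ := by
  obtain ⟨π₀, hπ₀, hWπ₀⟩ := hne
  have hdual : ∀ π : EuclideanSpace ℝ (Fin k), (∀ i, 0 ≤ π i) → Wᵀ.mulVec π = q →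
      |π.ofLp ⬝ᵥ r.ofLp| ≤ K * ‖r‖ := fun π h1 h2 =>
    (abs_dotProduct_le_norm_mul_norm π r).trans
      (mul_le_mul_of_nonneg_right (hK π h1 h2) (norm_nonneg r))
  have hlow : ∀ v ∈ {v : ℝ | ∃ u : Fin l → ℝ, (∀ i, r i ≤ W.mulVec u i) ∧ v = q ⬝ᵥ u},
      -(K * ‖r‖) ≤ v := by
    rintro _ ⟨u, hu, rfl⟩
    refine (abs_le.1 (hdual π₀ hπ₀ hWπ₀)).1.trans ?_
    rw [← hWπ₀, Matrix.mulVec_transpose, ← Matrix.dotProduct_mulVec]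
    exact Finset.sum_le_sum fun i _ => mul_le_mul_of_nonneg_left (hu i) (hπ₀ i)
  have hfeas : ∀ M, K * ‖r‖ < M →
      ∃ u : Fin l → ℝ, (∀ i, r i ≤ W.mulVec u i) ∧ q ⬝ᵥ u < M := fun M hM =>
    exists_feasible_dotProduct_lt W q r M ⟨π₀, hπ₀, hWπ₀⟩
      (eq_zero_of_mulVec_eq_zero_of_norm_le W q K π₀ hπ₀ hWπ₀ hK)
      (fun π h1 h2 => ((le_abs_self _).trans (hdual (WithLp.toLp 2 π) h1 h2)).trans_lt hM)
  refine abs_le.2 ⟨?_, le_of_forall_gt_imp_ge_of_dense fun M hM => ?_⟩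
  · obtain ⟨u, hu, -⟩ := hfeas _ (lt_add_one _)
    exact le_csInf ⟨_, u, hu, rfl⟩ hlow
  · obtain ⟨u, hu, hlt⟩ := hfeas M hM
    exact (csInf_le ⟨_, hlow⟩ ⟨u, hu, rfl⟩).trans hlt.le

/-- if the dual feasible set `D = {π ≥ 0 : Wᵀπ = q}` is nonempty and bounded
with `‖π‖ ≤ K₂` on `D`, then for `G(z,y) = cᵀz + Q(z,y)` and every `z` with `‖z‖ ≤ K₁`,
`|G(z,y)| ≤ K₁‖c‖ + K₂(‖b‖ + ‖H‖K₁ + ‖F‖‖y‖)` (operator norms w.r.t. Euclidean norms). -/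
theorem assessment_cost_affine_bound
    {k l n m : ℕ} (c : EuclideanSpace ℝ (Fin n)) (q : Fin l → ℝ)
    (b : EuclideanSpace ℝ (Fin k)) (W : Matrix (Fin k) (Fin l) ℝ)
    (H : Matrix (Fin k) (Fin n) ℝ) (F : Matrix (Fin k) (Fin m) ℝ)
    (G : EuclideanSpace ℝ (Fin n) → EuclideanSpace ℝ (Fin m) → ℝ)
    (hG : ∀ z y, G z y = (∑ i, c i * z i) + recourseQ W q b H F z y)
    (D : Set (EuclideanSpace ℝ (Fin k)))
    (hD : D = {π : EuclideanSpace ℝ (Fin k) | (∀ i, 0 ≤ π i) ∧ Wᵀ.mulVec π = q})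
    (hDne : D.Nonempty) (K₁ K₂ : ℝ) (hK₂ : ∀ π ∈ D, ‖π‖ ≤ K₂) :
    ∀ (z : EuclideanSpace ℝ (Fin n)) (y : EuclideanSpace ℝ (Fin m)), ‖z‖ ≤ K₁ →
      |G z y| ≤ K₁ * ‖c‖ + K₂ * (‖b‖ + euclideanOpNorm H * K₁ + euclideanOpNorm F * ‖y‖) := by
  intro z y hz
  subst hD
  obtain ⟨π₀, hπ₀⟩ := hDne
  have hK₂0 : 0 ≤ K₂ := (norm_nonneg _).trans (hK₂ π₀ hπ₀)
  have hQ := abs_sInf_le_of_dual_bounded W q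
    (b - Matrix.toEuclideanLin H z + Matrix.toEuclideanLin F y) K₂ ⟨π₀, hπ₀⟩
    (fun π h1 h2 => hK₂ π ⟨h1, h2⟩)
  have hr : ‖b - Matrix.toEuclideanLin H z + Matrix.toEuclideanLin F y‖ ≤
      ‖b‖ + euclideanOpNorm H * K₁ + euclideanOpNorm F * ‖y‖ :=
    (norm_add_le _ _).trans (add_le_add ((norm_sub_le _ _).trans (add_le_add le_rfl
      ((norm_toEuclideanLin_le H z).trans
        (mul_le_mul_of_nonneg_left hz (norm_nonneg _))))) (norm_toEuclideanLin_le F y))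
  have hc : |∑ i, c i * z i| ≤ K₁ * ‖c‖ := by
    refine (abs_dotProduct_le_norm_mul_norm c z).trans ?_
    rw [mul_comm]
    exact mul_le_mul_of_nonneg_right hz (norm_nonneg c)
  rw [hG]
  exact (abs_add_le _ _).trans
    (add_le_add hc (hQ.trans (mul_le_mul_of_nonneg_left hr hK₂0)))
end

section
/- Let c ∈ ℝ^n, q ∈ ℝ^l, b ∈ ℝ^k, W ∈ ℝ^{k×l}, H ∈ ℝ^{k×n}, F ∈ ℝ^{k×m}, let Q(z,y) := inf{qᵀu : W u ≥ b − H z + F y} and G(z,y) := cᵀz + Q(z,y), and suppose the dual feasible set D = {π ∈ ℝ^k : π ≥ 0, Wᵀπ = q} is nonempty and bounded. Let ζ : ℝ^m → ℝ^n be a continuous function whose range is bounded, let Ψ : ℝ^p × ℝ^d → ℝ^m be continuous, and let (X,Y) be a random vector in ℝ^d × ℝ^m with E‖Y‖ < ∞. Then for every θ ∈ ℝ^p the real random variable ω ↦ G(ζ(Ψ(θ, X(ω))), Y(ω)) is integrable. -/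
open Matrix MeasureTheory

/-- Gordan's alternative: if no nonzero `π ≥ 0` satisfies `Wᵀ π = 0`, then `W u ≥ 1` is
solvable. -/
theorem exists_one_le_mulVec {k l : ℕ} (W : Matrix (Fin k) (Fin l) ℝ)
    (hW : ∀ π : Fin k → ℝ, 0 ≤ π → Wᵀ *ᵥ π = 0 → π = 0) :
    ∃ u : Fin l → ℝ, ∀ i, 1 ≤ (W *ᵥ u) i := by
  by_cases h : ∃ u : Fin l → ℝ, ∀ i, 0 < (W *ᵥ u) i
  · obtain ⟨u, hu⟩ := h
    refine ⟨(∑ i, ((W *ᵥ u) i)⁻¹) • u, fun i => ?_⟩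
    rw [mulVec_smul, Pi.smul_apply, smul_eq_mul, ← inv_mul_cancel₀ (hu i).ne']
    exact mul_le_mul_of_nonneg_right
      (Finset.single_le_sum (f := fun j => ((W *ᵥ u) j)⁻¹)
        (fun j _ => (inv_pos.2 (hu j)).le) (Finset.mem_univ i)) (hu i).le
  exfalso
  let s : Set (Fin k → ℝ) := Set.univ.pi fun _ => Set.Ioi 0
  have hs : ∀ x, x ∈ s ↔ ∀ i, 0 < x i := fun x => by simp [s]
  have hdisj : Disjoint s (LinearMap.range W.mulVecLin : Set (Fin k → ℝ)) := by
    rw [Set.disjoint_left]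
    rintro x hx ⟨u, rfl⟩
    exact h ⟨u, (hs _).1 hx⟩
  obtain ⟨f, a, hfs, hft⟩ := geometric_hahn_banach_open
    (convex_pi fun _ _ => convex_Ioi (0 : ℝ))
    (isOpen_set_pi Set.finite_univ fun _ _ => isOpen_Ioi)
    (LinearMap.range W.mulVecLin).convex hdisj
  have ha : a ≤ 0 := by simpa using hft 0 (Submodule.zero_mem _)
  have hf0 : ∀ u, f (W *ᵥ u) = 0 := fun u => by
    by_contra hne
    have h1 := hft (W *ᵥ (((a - 1) / f (W *ᵥ u)) • u)) ⟨_, rfl⟩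
    rw [mulVec_smul, map_smul, smul_eq_mul, div_mul_cancel₀ _ hne] at h1
    linarith
  have hfsum : ∀ x, f x = ∑ i, x i * f (Pi.single i 1) := fun x => by
    conv_lhs => rw [pi_eq_sum_univ' x]
    simp [map_sum, Pi.single]
  have h1 : f 1 < 0 := (hfs 1 ((hs _).2 fun _ => one_pos)).trans_le ha
  have hnonpos : ∀ i, f (Pi.single i 1) ≤ 0 := fun i => by
    by_contra! hpos
    have hε : 0 < f (Pi.single i 1) / (-f 1) := div_pos hpos (by linarith)
    have h2 := hfs (Pi.single i 1 + (f (Pi.single i 1) / (-f 1)) • 1) ((hs _).2 fun j => by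
      have : (0 : ℝ) ≤ (Pi.single i 1 : Fin k → ℝ) j := by
        rw [Pi.single_apply]; split_ifs <;> norm_num
      simp only [Pi.add_apply, Pi.smul_apply, Pi.one_apply, smul_eq_mul, mul_one]
      linarith)
    rw [map_add, map_smul, smul_eq_mul, div_mul_eq_mul_div, mul_div_assoc, div_neg,
      div_self h1.ne] at h2
    linarith
  have hzero := hW (fun i => -f (Pi.single i 1)) (fun i => by simpa using hnonpos i) (by
    ext j
    have h3 := hf0 (Pi.single j 1)
    rw [hfsum] at h3
    simpa [mulVec, dotProduct, transpose_apply, Pi.single_apply] using h3)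
  rw [hfsum] at h1
  refine h1.ne (Finset.sum_eq_zero fun i _ => ?_)
  have := congrFun hzero i
  simp only [Pi.zero_apply, neg_eq_zero] at this
  rw [this, mul_zero]

/-- A nonempty bounded dual feasible set has no nonzero recession direction. -/
theorem eq_zero_of_isBounded_dualFeasible {k l : ℕ} (W : Matrix (Fin k) (Fin l) ℝ)
    (q : Fin l → ℝ)
    (hbdd : Bornology.IsBounded
      {π : EuclideanSpace ℝ (Fin k) | (∀ i, 0 ≤ π i) ∧ Wᵀ.mulVec π = q})
    {π₀ : EuclideanSpace ℝ (Fin k)} (h₀ : ∀ i, 0 ≤ π₀ i) (hq : Wᵀ.mulVec π₀ = q)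
    (π : Fin k → ℝ) (hπ : 0 ≤ π) (hWπ : Wᵀ *ᵥ π = 0) : π = 0 := by
  obtain ⟨R, hR⟩ := hbdd.exists_norm_le
  by_contra hne
  obtain ⟨i, hi⟩ := Function.ne_iff.1 hne
  have hi : 0 < π i := lt_of_le_of_ne (hπ i) (Ne.symm hi)
  have hR0 : 0 ≤ R := (norm_nonneg _).trans (hR π₀ ⟨h₀, hq⟩)
  have ht : 0 ≤ (R + 1) / π i := by positivity
  have hle := hR (π₀ + ((R + 1) / π i) • WithLp.toLp 2 π) ⟨fun j => by
      have := mul_nonneg ht (hπ j)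
      have := h₀ j
      simp only [PiLp.add_apply, PiLp.smul_apply, smul_eq_mul]
      linarith, by
      simp [mulVec_add, mulVec_smul, hWπ, hq]⟩
  have hcoord := (le_abs_self _).trans ((PiLp.norm_apply_le
    (π₀ + ((R + 1) / π i) • WithLp.toLp 2 π : EuclideanSpace ℝ (Fin k)) i).trans hle)
  simp only [PiLp.add_apply, PiLp.smul_apply, smul_eq_mul, div_mul_cancel₀ _ hi.ne'] at hcoord
  linarith [h₀ i]

/-- The optimal value of the linear program `inf {qᵀu : W u ≥ r}`. -/
noncomputable def lpValue {k l : ℕ} (W : Matrix (Fin k) (Fin l) ℝ) (q : Fin l → ℝ)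
    (r : Fin k → ℝ) : ℝ :=
  sInf {v : ℝ | ∃ u : Fin l → ℝ, (∀ i, r i ≤ W.mulVec u i) ∧ v = q ⬝ᵥ u}

/-- Weak duality. -/
theorem dotProduct_le_of_dualFeasible {k l : ℕ} {W : Matrix (Fin k) (Fin l) ℝ}
    {q : Fin l → ℝ} {π r : Fin k → ℝ} {u : Fin l → ℝ} (hπ : ∀ i, 0 ≤ π i)
    (hq : Wᵀ *ᵥ π = q) (hu : ∀ i, r i ≤ (W *ᵥ u) i) : π ⬝ᵥ r ≤ q ⬝ᵥ u := by
  rw [← hq, mulVec_transpose, ← dotProduct_mulVec]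
  exact Finset.sum_le_sum fun i _ => mul_le_mul_of_nonneg_left (hu i) (hπ i)

theorem exists_lipschitzWith_lpValue {k l : ℕ} (W : Matrix (Fin k) (Fin l) ℝ)
    (q : Fin l → ℝ) {π : Fin k → ℝ} (hπ : ∀ i, 0 ≤ π i) (hq : Wᵀ *ᵥ π = q)
    {u₀ : Fin l → ℝ} (hu₀ : ∀ i, 1 ≤ (W *ᵥ u₀) i) :
    ∃ K, LipschitzWith K (lpValue W q) := by
  refine ⟨(q ⬝ᵥ u₀).toNNReal, LipschitzWith.of_le_add_mul' _ fun r s => ?_⟩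
  have hbelow : BddBelow {v : ℝ | ∃ u : Fin l → ℝ, (∀ i, r i ≤ W.mulVec u i) ∧ v = q ⬝ᵥ u} :=
    ⟨π ⬝ᵥ r, by rintro _ ⟨u, hu, rfl⟩; exact dotProduct_le_of_dualFeasible hπ hq hu⟩
  have hne : {v : ℝ | ∃ u : Fin l → ℝ, (∀ i, s i ≤ W.mulVec u i) ∧ v = q ⬝ᵥ u}.Nonempty := by
    refine ⟨_, ‖s‖ • u₀, fun i => ?_, rfl⟩
    rw [mulVec_smul, Pi.smul_apply, smul_eq_mul]
    exact ((le_abs_self _).trans (norm_le_pi_norm s i)).trans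
      (le_mul_of_one_le_right (norm_nonneg s) (hu₀ i))
  rw [← sub_le_iff_le_add]
  refine le_csInf hne ?_
  rintro _ ⟨u, hu, rfl⟩
  rw [sub_le_iff_le_add]
  refine csInf_le hbelow ⟨u + dist r s • u₀, fun i => ?_, ?_⟩
  · rw [mulVec_add, mulVec_smul, Pi.add_apply, Pi.smul_apply, smul_eq_mul]
    have h1 : r i - s i ≤ dist r s := (le_abs_self _).trans (dist_le_pi_dist r s i)
    have h2 := le_mul_of_one_le_right (dist_nonneg (x := r) (y := s)) (hu₀ i)
    linarith [hu i]
  · rw [dotProduct_add, dotProduct_smul, smul_eq_mul, mul_comm]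

theorem LipschitzWith.integrable_comp {Ω E : Type*} [MeasurableSpace Ω] {P : Measure Ω}
    [IsFiniteMeasure P] [NormedAddCommGroup E] {K : NNReal} {φ : E → ℝ}
    (hφ : LipschitzWith K φ) {r : Ω → E} (hr : Integrable r P) :
    Integrable (fun ω => φ (r ω)) P := by
  refine ((hr.norm.const_mul (K : ℝ)).add (integrable_const ‖φ 0‖)).mono'
    (hφ.continuous.comp_aestronglyMeasurable hr.aestronglyMeasurable) (.of_forall fun ω => ?_)
  have h1 := hφ.norm_sub_le (r ω) 0
  rw [sub_zero] at h1
  have h2 := norm_sub_norm_le (φ (r ω)) (φ 0)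
  simp only [Pi.add_apply]
  linarith

theorem MeasureTheory.Integrable.mulVec_euclidean {Ω : Type*} [MeasurableSpace Ω]
    {P : Measure Ω} {k n : ℕ}
    (A : Matrix (Fin k) (Fin n) ℝ) {Z : Ω → EuclideanSpace ℝ (Fin n)} (hZ : Integrable Z P) :
    Integrable (fun ω => A *ᵥ (Z ω).ofLp) P :=
  (A.mulVecLin ∘ₗ (WithLp.linearEquiv 2 ℝ (Fin n → ℝ)).toLinearMap).toContinuousLinearMap
    |>.integrable_comp hZ

/-- with `G(z,y) = cᵀz + Q(z,y)`, a nonempty bounded dual feasible set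
`D = {π ≥ 0 : Wᵀπ = q}`, a continuous `ζ` with bounded range, a continuous `Ψ`, and a
random vector `(X,Y)` with `E‖Y‖ < ∞`, the composite cost `ω ↦ G(ζ(Ψ(θ,X)),Y)` is
integrable for every `θ`. -/
theorem composite_assessment_cost_integrable
    {k l n m p d : ℕ} (c : EuclideanSpace ℝ (Fin n)) (q : Fin l → ℝ)
    (b : Fin k → ℝ) (W : Matrix (Fin k) (Fin l) ℝ)
    (H : Matrix (Fin k) (Fin n) ℝ) (F : Matrix (Fin k) (Fin m) ℝ)
    (G : EuclideanSpace ℝ (Fin n) → EuclideanSpace ℝ (Fin m) → ℝ)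
    (hG : ∀ z y, G z y = (∑ i, c i * z i) + recourseQ W q b H F z y)
    (D : Set (EuclideanSpace ℝ (Fin k)))
    (hD : D = {π : EuclideanSpace ℝ (Fin k) | (∀ i, 0 ≤ π i) ∧ Wᵀ.mulVec π = q})
    (hDne : D.Nonempty) (hDbdd : Bornology.IsBounded D)
    (ζ : EuclideanSpace ℝ (Fin m) → EuclideanSpace ℝ (Fin n))
    (hζc : Continuous ζ) (hζb : Bornology.IsBounded (Set.range ζ))
    (Ψ : EuclideanSpace ℝ (Fin p) → EuclideanSpace ℝ (Fin d) → EuclideanSpace ℝ (Fin m))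
    (hΨ : Continuous fun q : EuclideanSpace ℝ (Fin p) × EuclideanSpace ℝ (Fin d) => Ψ q.1 q.2)
    {Ω : Type*} [MeasurableSpace Ω] (P : Measure Ω) [IsProbabilityMeasure P]
    (X : Ω → EuclideanSpace ℝ (Fin d)) (Y : Ω → EuclideanSpace ℝ (Fin m))
    (hX : Measurable X) (hY : Measurable Y)
    (hYint : Integrable (fun ω => ‖Y ω‖) P) :
    ∀ θ : EuclideanSpace ℝ (Fin p),
      Integrable (fun ω => G (ζ (Ψ θ (X ω))) (Y ω)) P := by
  intro θ
  subst hD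
  obtain ⟨π₀, hπ₀, hq⟩ := hDne
  obtain ⟨u₀, hu₀⟩ := exists_one_le_mulVec W
    (eq_zero_of_isBounded_dualFeasible W q hDbdd hπ₀ hq)
  obtain ⟨K, hK⟩ := exists_lipschitzWith_lpValue W q hπ₀ hq hu₀
  obtain ⟨R, hR⟩ := hζb.exists_norm_le
  have hΨθ : Continuous (Ψ θ) := hΨ.comp (Continuous.prodMk_right θ)
  have hZ : Integrable (fun ω => ζ (Ψ θ (X ω))) P :=
    .of_bound ((hζc.comp hΨθ).measurable.comp hX).aestronglyMeasurable R
      (.of_forall fun ω => hR _ ⟨_, rfl⟩)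
  have hYi : Integrable Y P := (integrable_norm_iff hY.aestronglyMeasurable).1 hYint
  have hQ := hK.integrable_comp
    (((integrable_const b).sub (hZ.mulVec_euclidean H)).add (hYi.mulVec_euclidean F))
  simp only [hG]
  exact (integrable_finsetSum _ fun i _ =>
    ((EuclideanSpace.proj (𝕜 := ℝ) i).integrable_comp hZ).const_mul (c i)).add hQ
end

section
/- Let Θ ⊆ ℝ^p be a nonempty compact set, let Z = {z ∈ ℝ^n : A_Z z ≥ h} be a nonempty bounded polyhedron, and let Ψ : ℝ^p × ℝ^d → ℝ^m be continuous. Let Q_p, G_p, Q_a, G_a and the dual feasible sets D_p, D_a be as in the shared definitions, and assume D_p and D_a are nonempty and bounded, and that for every y ∈ ℝ^m the set argmin_{z∈Z} G_p(z,y) is a singleton with unique element ζ(y). Let (X,Y) be a random vector in ℝ^d × ℝ^m with E‖Y‖ < ∞. Then the function φ(θ) := E[G_a(ζ(Ψ(θ,X)), Y)] is finite-valued and continuous on Θ. -/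
open Matrix MeasureTheory

open Set in
/-- The unique minimizer over a compact set of a jointly continuous parametric objective depends
continuously on the parameter. -/
theorem continuous_of_unique_minimizer {E T : Type*} [TopologicalSpace E] [TopologicalSpace T]
    {K : Set E} (hK : IsCompact K) {g : E → T → ℝ}
    (hg : Continuous fun x : E × T => g x.1 x.2) {ζ : T → E}
    (hζ : ∀ y, {z | z ∈ K ∧ ∀ z' ∈ K, g z y ≤ g z' y} = {ζ y}) : Continuous ζ := by
  have : CompactSpace K := isCompact_iff_compactSpace.mp hK
  have hmem : ∀ y, ζ y ∈ K ∧ ∀ z' ∈ K, g (ζ y) y ≤ g z' y := fun y => by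
    have : ζ y ∈ {z | z ∈ K ∧ ∀ z' ∈ K, g z y ≤ g z' y} := by rw [hζ y]; rfl
    exact this
  refine continuous_iff_isClosed.mpr fun C hC => ?_
  have hS : IsClosed {x : K × T | (x.1 : E) ∈ C ∧ ∀ z' : K, g x.1 x.2 ≤ g z' x.2} := by
    refine (hC.preimage (by fun_prop)).and ?_
    simp only [ofPred_forall]
    exact isClosed_iInter fun z' => isClosed_le
      (hg.comp ((continuous_subtype_val.comp continuous_fst).prodMk continuous_snd))
      (hg.comp (continuous_const.prodMk continuous_snd))
  convert isClosedMap_snd_of_compactSpace _ hS using 1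
  ext y
  constructor
  · intro hy
    exact ⟨(⟨ζ y, (hmem y).1⟩, y), ⟨hy, fun z' => (hmem y).2 z' z'.2⟩, rfl⟩
  · rintro ⟨⟨z, y'⟩, ⟨hzC, hz⟩, rfl⟩
    have : (z : E) ∈ {w | w ∈ K ∧ ∀ z' ∈ K, g w y' ≤ g z' y'} :=
      ⟨z.2, fun z' hz' => hz ⟨z', hz'⟩⟩
    rw [hζ y', mem_singleton_iff] at this
    simpa [← this] using hzC

/-- Gordan's alternative for a dual feasible set: if `{π ≥ 0, Wᵀπ = q}` is nonempty and bounded,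
then `W u ≥ 1` is solvable. -/
theorem exists_one_le_mulVec_of_isBounded_dual {k l : ℕ} {W : Matrix (Fin k) (Fin l) ℝ}
    {q : Fin l → ℝ} {D : Set (EuclideanSpace ℝ (Fin k))}
    (hD : D = {π : EuclideanSpace ℝ (Fin k) | (∀ i, 0 ≤ π i) ∧ Wᵀ.mulVec π = q})
    (hne : D.Nonempty) (hbdd : Bornology.IsBounded D) :
    ∃ u : Fin l → ℝ, ∀ i, 1 ≤ W.mulVec u i := by
  have h0 : (0 : Fin l → ℝ) ∉ Wᵀ.mulVecLin '' stdSimplex ℝ (Fin k) := by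
    rintro ⟨π, ⟨hπ, hsum⟩, hWπ⟩
    rw [Matrix.mulVecLin_apply] at hWπ
    obtain ⟨π₀, hπ₀⟩ := hne
    obtain ⟨C, hC⟩ := hbdd.exists_norm_le
    have hi : ∃ i, 0 < π i := by
      by_contra! hcon
      have := Finset.sum_nonpos fun i (_ : i ∈ Finset.univ) => hcon i
      linarith
    obtain ⟨i, hi⟩ := hi
    have hC0 : 0 ≤ C := (norm_nonneg _).trans (hC π₀ hπ₀)
    have ht : 0 ≤ (C + 1) / π i := by positivity
    have hmem : π₀ + ((C + 1) / π i) • WithLp.toLp 2 π ∈ D := by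
      rw [hD] at hπ₀ ⊢
      refine ⟨fun j => ?_, ?_⟩
      · have := hπ₀.1 j
        have := mul_nonneg ht (hπ j)
        simp only [PiLp.add_apply, PiLp.smul_apply, smul_eq_mul]
        linarith
      · simp [Matrix.mulVec_add, Matrix.mulVec_smul, hWπ, hπ₀.2]
    have h1 := (PiLp.norm_apply_le _ i).trans (hC _ hmem)
    have h2 : 0 ≤ π₀ i := by
      rw [hD] at hπ₀
      exact hπ₀.1 i
    simp only [PiLp.add_apply, PiLp.smul_apply, smul_eq_mul, div_mul_cancel₀ _ hi.ne'] at h1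
    linarith [Real.le_norm_self (π₀ i + (C + 1))]
  obtain ⟨f, c, hc, hf⟩ := geometric_hahn_banach_point_closed
    ((convex_stdSimplex ℝ (Fin k)).linear_image Wᵀ.mulVecLin)
    ((isCompact_stdSimplex ℝ (Fin k)).image
      (LinearMap.continuous_of_finiteDimensional _)).isClosed h0
  rw [map_zero] at hc
  refine ⟨fun j => c⁻¹ * f (Pi.single j 1), fun i => ?_⟩
  have hfi := hf _ ⟨_, single_mem_stdSimplex ℝ i, rfl⟩
  have hrow : Wᵀ.mulVecLin (Pi.single i 1) = ∑ j, W i j • (Pi.single j 1 : Fin l → ℝ) := by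
    ext j
    simp [Finset.sum_apply, Pi.single_apply]
  rw [hrow, map_sum] at hfi
  have : W.mulVec (fun j => c⁻¹ * f (Pi.single j 1)) i
      = c⁻¹ * ∑ j, f (W i j • (Pi.single j 1 : Fin l → ℝ)) := by
    simp only [Matrix.mulVec, dotProduct, Finset.mul_sum, map_smul, smul_eq_mul]
    exact Finset.sum_congr rfl fun j _ => by ring
  rw [this, ← div_eq_inv_mul, one_le_div hc]
  exact hfi.le

/-- The optimal value of `min {qᵀu : W u ≥ t}` is Lipschitz in the right-hand side `t` as soon as
the dual feasible set is nonempty and bounded. -/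
theorem exists_lipschitzWith_sInf_of_isBounded_dual {k l : ℕ} {W : Matrix (Fin k) (Fin l) ℝ}
    {q : Fin l → ℝ} {D : Set (EuclideanSpace ℝ (Fin k))}
    (hD : D = {π : EuclideanSpace ℝ (Fin k) | (∀ i, 0 ≤ π i) ∧ Wᵀ.mulVec π = q})
    (hne : D.Nonempty) (hbdd : Bornology.IsBounded D) :
    ∃ K, LipschitzWith K fun t : Fin k → ℝ =>
      sInf {v : ℝ | ∃ u : Fin l → ℝ, (∀ i, t i ≤ W.mulVec u i) ∧ v = q ⬝ᵥ u} := by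
  obtain ⟨u₀, hu₀⟩ := exists_one_le_mulVec_of_isBounded_dual hD hne hbdd
  obtain ⟨π, hπ⟩ := hne
  rw [hD] at hπ
  have hshift : ∀ (t t' : Fin k → ℝ) (u : Fin l → ℝ), (∀ i, t i ≤ W.mulVec u i) →
      ∀ i, t' i ≤ W.mulVec (u + dist t' t • u₀) i := fun t t' u hu i => by
    have h1 : t' i - t i ≤ dist t' t := (le_abs_self _).trans (dist_le_pi_dist t' t i)
    have h2 := mul_le_mul_of_nonneg_left (hu₀ i) (dist_nonneg (x := t') (y := t))
    rw [Matrix.mulVec_add, Matrix.mulVec_smul, Pi.add_apply, Pi.smul_apply, smul_eq_mul]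
    linarith [hu i]
  have hbelow : ∀ t : Fin k → ℝ,
      BddBelow {v : ℝ | ∃ u : Fin l → ℝ, (∀ i, t i ≤ W.mulVec u i) ∧ v = q ⬝ᵥ u} := by
    refine fun t => ⟨∑ i, π i * t i, ?_⟩
    rintro _ ⟨u, hu, rfl⟩
    calc ∑ i, π i * t i ≤ π ⬝ᵥ W.mulVec u :=
          Finset.sum_le_sum fun i _ => mul_le_mul_of_nonneg_left (hu i) (hπ.1 i)
      _ = q ⬝ᵥ u := by rw [Matrix.dotProduct_mulVec, ← Matrix.mulVec_transpose, hπ.2]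
  have hnonempty : ∀ t : Fin k → ℝ,
      {v : ℝ | ∃ u : Fin l → ℝ, (∀ i, t i ≤ W.mulVec u i) ∧ v = q ⬝ᵥ u}.Nonempty :=
    fun t => ⟨_, _, hshift 0 t 0 (by simp), rfl⟩
  refine ⟨(|q ⬝ᵥ u₀|).toNNReal, LipschitzWith.of_le_add_mul _ fun t' t => ?_⟩
  rw [Real.coe_toNNReal _ (abs_nonneg _), ← sub_le_iff_le_add]
  refine le_csInf (hnonempty t) ?_
  rintro _ ⟨u, hu, rfl⟩
  have h1 := csInf_le (hbelow t') ⟨_, hshift t t' u hu, rfl⟩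
  rw [dotProduct_add, dotProduct_smul, smul_eq_mul] at h1
  have h2 := mul_le_mul_of_nonneg_right (le_abs_self (q ⬝ᵥ u₀)) (dist_nonneg (x := t') (y := t))
  linarith

/-- Under a nonempty bounded dual feasible set, the recourse cost is jointly Lipschitz. -/
theorem exists_lipschitzWith_add_recourseQ {k l n m : ℕ} {W : Matrix (Fin k) (Fin l) ℝ}
    {q : Fin l → ℝ} {D : Set (EuclideanSpace ℝ (Fin k))}
    (hD : D = {π : EuclideanSpace ℝ (Fin k) | (∀ i, 0 ≤ π i) ∧ Wᵀ.mulVec π = q})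
    (hne : D.Nonempty) (hbdd : Bornology.IsBounded D) (b : Fin k → ℝ)
    (H : Matrix (Fin k) (Fin n) ℝ) (F : Matrix (Fin k) (Fin m) ℝ)
    (c : EuclideanSpace ℝ (Fin n)) :
    ∃ K, LipschitzWith K fun x : EuclideanSpace ℝ (Fin n) × EuclideanSpace ℝ (Fin m) =>
      (∑ i, c i * x.1 i) + recourseQ W q b H F x.1 x.2 := by
  obtain ⟨K, hK⟩ := exists_lipschitzWith_sInf_of_isBounded_dual hD hne hbdd
  let L : EuclideanSpace ℝ (Fin n) × EuclideanSpace ℝ (Fin m) →L[ℝ] (Fin k → ℝ) :=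
    LinearMap.toContinuousLinearMap
      ((F.mulVecLin ∘ₗ (WithLp.linearEquiv 2 ℝ (Fin m → ℝ)).toLinearMap ∘ₗ LinearMap.snd ℝ _ _)
        - (H.mulVecLin ∘ₗ (WithLp.linearEquiv 2 ℝ (Fin n → ℝ)).toLinearMap ∘ₗ
          LinearMap.fst ℝ _ _))
  have hL := hK.comp ((LipschitzWith.const b).add L.lipschitz)
  have hc := ((innerSL ℝ c).comp (ContinuousLinearMap.fst ℝ (EuclideanSpace ℝ (Fin n))
    (EuclideanSpace ℝ (Fin m)))).lipschitz
  have hfun : ∀ x : EuclideanSpace ℝ (Fin n) × EuclideanSpace ℝ (Fin m),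
      (∑ i, c i * x.1 i) + recourseQ W q b H F x.1 x.2 = inner ℝ c x.1 +
        sInf {v : ℝ | ∃ u : Fin l → ℝ, (∀ i, (b + L x) i ≤ W.mulVec u i) ∧ v = q ⬝ᵥ u} := by
    intro x
    have hrhs : ∀ i, (b + L x) i = b i - H.mulVec x.1 i + F.mulVec x.2 i := fun i => by
      simp only [Pi.add_apply]
      change b i + (F.mulVec x.2 i - H.mulVec x.1 i) = _
      ring
    simp only [hrhs, recourseQ, PiLp.inner_apply, RCLike.inner_apply, conj_trivial, mul_comm]
  rw [funext hfun]
  exact ⟨_, hc.add hL⟩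

/-- under the paper's assumptions (nonempty compact `Θ`, nonempty bounded
polyhedron `Z`, continuous `Ψ`, nonempty bounded dual feasible sets `D_p` and `D_a`,
unique lower-level minimizer `ζ(y)` of `G_p(·,y)` over `Z`, and `E‖Y‖ < ∞`), the expected
assessment cost `φ(θ) = E[G_a(ζ(Ψ(θ,X)),Y)]` is finite-valued and continuous on `Θ`. -/
theorem expected_assessment_cost_finite_continuous
    {p d n m s kp lp ka la : ℕ}
    (Θ : Set (EuclideanSpace ℝ (Fin p))) (hΘne : Θ.Nonempty) (hΘc : IsCompact Θ)
    (AZ : Matrix (Fin s) (Fin n) ℝ) (h : Fin s → ℝ)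
    (Z : Set (EuclideanSpace ℝ (Fin n)))
    (hZ : Z = {z : EuclideanSpace ℝ (Fin n) | ∀ j, h j ≤ AZ.mulVec z j})
    (hZne : Z.Nonempty) (hZbdd : Bornology.IsBounded Z)
    (Ψ : EuclideanSpace ℝ (Fin p) → EuclideanSpace ℝ (Fin d) → EuclideanSpace ℝ (Fin m))
    (hΨ : Continuous fun q : EuclideanSpace ℝ (Fin p) × EuclideanSpace ℝ (Fin d) => Ψ q.1 q.2)
    (cp : EuclideanSpace ℝ (Fin n)) (qp : Fin lp → ℝ) (bp : Fin kp → ℝ)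
    (Wp : Matrix (Fin kp) (Fin lp) ℝ) (Hp : Matrix (Fin kp) (Fin n) ℝ)
    (Fp : Matrix (Fin kp) (Fin m) ℝ)
    (ca : EuclideanSpace ℝ (Fin n)) (qa : Fin la → ℝ) (ba : Fin ka → ℝ)
    (Wa : Matrix (Fin ka) (Fin la) ℝ) (Ha : Matrix (Fin ka) (Fin n) ℝ)
    (Fa : Matrix (Fin ka) (Fin m) ℝ)
    (Gp Ga : EuclideanSpace ℝ (Fin n) → EuclideanSpace ℝ (Fin m) → ℝ)
    (hGp : ∀ z y, Gp z y = (∑ i, cp i * z i) + recourseQ Wp qp bp Hp Fp z y)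
    (hGa : ∀ z y, Ga z y = (∑ i, ca i * z i) + recourseQ Wa qa ba Ha Fa z y)
    (Dp : Set (EuclideanSpace ℝ (Fin kp)))
    (hDp : Dp = {π : EuclideanSpace ℝ (Fin kp) | (∀ i, 0 ≤ π i) ∧ Wpᵀ.mulVec π = qp})
    (hDpne : Dp.Nonempty) (hDpbdd : Bornology.IsBounded Dp)
    (Da : Set (EuclideanSpace ℝ (Fin ka)))
    (hDa : Da = {π : EuclideanSpace ℝ (Fin ka) | (∀ i, 0 ≤ π i) ∧ Waᵀ.mulVec π = qa})
    (hDane : Da.Nonempty) (hDabdd : Bornology.IsBounded Da)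
    (ζ : EuclideanSpace ℝ (Fin m) → EuclideanSpace ℝ (Fin n))
    (hζ : ∀ y, {z | z ∈ Z ∧ ∀ z' ∈ Z, Gp z y ≤ Gp z' y} = {ζ y})
    {Ω : Type*} [MeasurableSpace Ω] (P : Measure Ω) [IsProbabilityMeasure P]
    (X : Ω → EuclideanSpace ℝ (Fin d)) (Y : Ω → EuclideanSpace ℝ (Fin m))
    (hX : Measurable X) (hY : Measurable Y)
    (hYint : Integrable (fun ω => ‖Y ω‖) P)
    (φ : EuclideanSpace ℝ (Fin p) → ℝ)
    (hφ : ∀ θ, φ θ = ∫ ω, Ga (ζ (Ψ θ (X ω))) (Y ω) ∂P) :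
    (∀ θ ∈ Θ, Integrable (fun ω => Ga (ζ (Ψ θ (X ω))) (Y ω)) P) ∧
    ContinuousOn φ Θ := by
  have hZc : IsCompact Z := by
    refine Metric.isCompact_of_isClosed_isBounded ?_ hZbdd
    simp only [hZ, Set.ofPred_forall]
    refine isClosed_iInter fun j => isClosed_le continuous_const ?_
    exact (continuous_apply j).comp
      (Continuous.matrix_mulVec continuous_const (PiLp.continuous_ofLp 2 _))
  obtain ⟨Kp, hKp⟩ := exists_lipschitzWith_add_recourseQ hDp hDpne hDpbdd bp Hp Fp cp
  obtain ⟨Ka, hKa⟩ := exists_lipschitzWith_add_recourseQ hDa hDane hDabdd ba Ha Fa ca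
  simp only [← hGp] at hKp
  simp only [← hGa] at hKa
  have hζcont : Continuous ζ := continuous_of_unique_minimizer hZc hKp.continuous hζ
  have hζZ : ∀ y, ζ y ∈ Z := fun y => by
    have : ζ y ∈ {z | z ∈ Z ∧ ∀ z' ∈ Z, Gp z y ≤ Gp z' y} := by rw [hζ y]; rfl
    exact this.1
  obtain ⟨R, hR⟩ := hZbdd.exists_norm_le
  have hmeas : ∀ θ, AEStronglyMeasurable (fun ω => Ga (ζ (Ψ θ (X ω))) (Y ω)) P := fun θ => by
    have hΨθ : Measurable (Ψ θ) := (hΨ.comp (Continuous.prodMk_right θ)).measurable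
    exact (hKa.continuous.measurable.comp
      ((hζcont.measurable.comp (hΨθ.comp hX)).prodMk hY)).aestronglyMeasurable
  have hbound : ∀ θ, ∀ᵐ ω ∂P, ‖Ga (ζ (Ψ θ (X ω))) (Y ω)‖ ≤ ‖Ga 0 0‖ + Ka * (R + ‖Y ω‖) := by
    refine fun θ => Filter.Eventually.of_forall fun ω => ?_
    have h1 := hKa.norm_sub_le (ζ (Ψ θ (X ω)), Y ω) 0
    have h2 : ‖(ζ (Ψ θ (X ω)), Y ω)‖ ≤ R + ‖Y ω‖ := by
      have := hR _ (hζZ (Ψ θ (X ω)))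
      have := norm_nonneg (ζ (Ψ θ (X ω)))
      refine max_le ?_ ?_ <;> simp only <;> linarith [norm_nonneg (Y ω)]
    rw [sub_zero] at h1
    have h3 := mul_le_mul_of_nonneg_left h2 Ka.coe_nonneg
    have h4 := norm_le_norm_add_norm_sub' (Ga (ζ (Ψ θ (X ω))) (Y ω)) (Ga 0 0)
    simp only [Prod.fst_zero, Prod.snd_zero] at h1
    linarith
  have hint : Integrable (fun ω => ‖Ga 0 0‖ + Ka * (R + ‖Y ω‖)) P :=
    (integrable_const _).add (((integrable_const _).add hYint).const_mul _)
  refine ⟨fun θ _ => hint.mono' (hmeas θ) (hbound θ), ?_⟩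
  rw [funext hφ]
  refine (continuous_of_dominated hmeas hbound hint (.of_forall fun ω => ?_)).continuousOn
  exact hKa.continuous.comp ((hζcont.comp
    (hΨ.comp (Continuous.prodMk_left (X ω)))).prodMk continuous_const)
end
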